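/- arXiv:2107.04891 — 3 statements merged into one kernel-verified Lean document; each statement's English description precedes it below -/
import Mathlib

section
/- If G is a weakly characteristic typed graph for a shape graph S, then for every context C = (t,a) and every typeset T ∈ Typesets(S): if there exists t' ∈ T with maxarity_S^C(t') = ∞ then maxoccur^C_G(T) ≥ |T| + 1, and otherwise maxoccur^C_G(T) = Σ_{t'∈T} maxarity_S^C(t'). -/
noncomputable section

namespace ShEx0

/-- An interval `[lo; hi]` with `lo : ℕ` and `hi : ℕ∞`; it denotes `{k : ℕ | lo ≤ k ∧ k ≤ hi}`. -/
def IvMem (p : ℕ × ℕ∞) (k : ℕ) : Prop := p.1 ≤ k ∧ (k : ℕ∞) ≤ p.2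

/-- The basic intervals `M = {[0;0],[0;1],[1;1],[1;∞],[0;∞]}`. -/
def IvBasic (p : ℕ × ℕ∞) : Prop := p.1 ≤ 1 ∧ (p.2 ≤ 1 ∨ p.2 = ⊤)

/-- A shape graph: an assignment of a basic interval to every triple (type, label, type). -/
structure ShapeGraph (Lab Ty : Type) where
  arity : Ty → Lab → Ty → ℕ × ℕ∞
  basic : ∀ t a s, IvBasic (arity t a s)

/-- A typed graph over node set `ℕ`, with labeled edges and a typing function. -/
structure TypedGraph (Lab Ty : Type) where
  nodes : Set ℕ
  edges : Set (ℕ × Lab × ℕ)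
  typing : ℕ → Set Ty
  nodes_finite : nodes.Finite
  edges_sub : ∀ e ∈ edges, e.1 ∈ nodes ∧ e.2.2 ∈ nodes

variable {Lab Ty : Type}

/-- Outbound edges of a node. -/
def TypedGraph.out (G : TypedGraph Lab Ty) (n : ℕ) : Set (ℕ × Lab × ℕ) :=
  {e | e ∈ G.edges ∧ e.1 = n}

/-- `R` is a post-fixpoint of the satisfaction operator: each `(n,t) ∈ R` admits a witness `λ`. -/
def IsPostfix (S : ShapeGraph Lab Ty) (G : TypedGraph Lab Ty) (R : ℕ → Ty → Prop) : Prop :=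
  ∀ n t, R n t → ∃ lam : ℕ × Lab × ℕ → Ty,
    (∀ e ∈ G.out n, R e.2.2 (lam e)) ∧
    ∀ a s, IvMem (S.arity t a s) (Set.ncard {e | e ∈ G.out n ∧ e.2.1 = a ∧ lam e = s})

/-- The satisfaction relation: the greatest relation satisfying the unfolding condition,
    i.e. the union of all post-fixpoints. -/
def Sat (S : ShapeGraph Lab Ty) (G : TypedGraph Lab Ty) (n : ℕ) (t : Ty) : Prop :=
  ∃ R, IsPostfix S G R ∧ R n t

/-- The language of a shape graph: typed graphs whose typing is exactly the satisfaction
    relation and is proper (nonempty on every node). -/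
def Lang (S : ShapeGraph Lab Ty) : Set (TypedGraph Lab Ty) :=
  {G | (∀ n ∈ G.nodes, G.typing n = {t | Sat S G n t}) ∧ ∀ n ∈ G.nodes, (G.typing n).Nonempty}

/-- `t1 ⊆_S t2`. -/
def TypeSub (S : ShapeGraph Lab Ty) (t1 t2 : Ty) : Prop :=
  ∀ G ∈ Lang S, ∀ n ∈ G.nodes, t1 ∈ G.typing n → t2 ∈ G.typing n

/-- `t1 =_S t2`. -/
def TypeEq (S : ShapeGraph Lab Ty) (t1 t2 : Ty) : Prop :=
  TypeSub S t1 t2 ∧ TypeSub S t2 t1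

/-- `Typesets(S)`. -/
def Typesets (S : ShapeGraph Lab Ty) : Set (Set Ty) :=
  {T | ∃ G ∈ Lang S, ∃ n ∈ G.nodes, G.typing n = T}

/-- The lower endpoint of the arity in a context `C = (t,a)`. -/
def minarity (S : ShapeGraph Lab Ty) (C : Ty × Lab) (s : Ty) : ℕ := (S.arity C.1 C.2 s).1

/-- The upper endpoint of the arity in a context `C = (t,a)`. -/
def maxarity (S : ShapeGraph Lab Ty) (C : Ty × Lab) (s : Ty) : ℕ∞ := (S.arity C.1 C.2 s).2

/-- `cnt^C_G(n,T)`: number of `C.2`-successors of `n` whose typeset is exactly `T`. -/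
def cntT (G : TypedGraph Lab Ty) (C : Ty × Lab) (n : ℕ) (T : Set Ty) : ℕ :=
  Set.ncard {m | (n, C.2, m) ∈ G.edges ∧ G.typing m = T}

/-- `cnt^C_G(n,s)`: number of `C.2`-successors of `n` having type `s`. -/
def cntt (G : TypedGraph Lab Ty) (C : Ty × Lab) (n : ℕ) (s : Ty) : ℕ :=
  Set.ncard {m | (n, C.2, m) ∈ G.edges ∧ s ∈ G.typing m}

/-- The set of counts `cnt^C_G(n,T)` over nodes `n` having type `C.1`. -/
def occT (G : TypedGraph Lab Ty) (C : Ty × Lab) (T : Set Ty) : Set ℕ :=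
  {k | ∃ n ∈ G.nodes, C.1 ∈ G.typing n ∧ cntT G C n T = k}

/-- The set of counts `cnt^C_G(n,s)` over nodes `n` having type `C.1`. -/
def occt (G : TypedGraph Lab Ty) (C : Ty × Lab) (s : Ty) : Set ℕ :=
  {k | ∃ n ∈ G.nodes, C.1 ∈ G.typing n ∧ cntt G C n s = k}

def minoccurT (G : TypedGraph Lab Ty) (C : Ty × Lab) (T : Set Ty) : ℕ := sInf (occT G C T)
def maxoccurT (G : TypedGraph Lab Ty) (C : Ty × Lab) (T : Set Ty) : ℕ := sSup (occT G C T)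
def minoccurt (G : TypedGraph Lab Ty) (C : Ty × Lab) (s : Ty) : ℕ := sInf (occt G C s)
def maxoccurt (G : TypedGraph Lab Ty) (C : Ty × Lab) (s : Ty) : ℕ := sSup (occt G C s)

/-- `G` is weakly characteristic for `S`. -/
def WeaklyChar (S : ShapeGraph Lab Ty) (G : TypedGraph Lab Ty) : Prop :=
  G ∈ Lang S ∧
  (∀ T ∈ Typesets S, ∃ n ∈ G.nodes, G.typing n = T) ∧
  ∀ C : Ty × Lab, ∀ T ∈ Typesets S,
    (∃ n ∈ G.nodes, C.1 ∈ G.typing n ∧ cntT G C n T = ∑ᶠ t' ∈ T, minarity S C t') ∧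
    (∃ n' ∈ G.nodes, C.1 ∈ G.typing n' ∧
      ((∑ᶠ t' ∈ T, maxarity S C t') ≠ ⊤ →
          (cntT G C n' T : ℕ∞) = ∑ᶠ t' ∈ T, maxarity S C t') ∧
      ((∑ᶠ t' ∈ T, maxarity S C t') = ⊤ → T.ncard + 1 ≤ cntT G C n' T))

section Rules

variable (lt : Ty → Ty → Prop)

/-- A single application of rule (R1) in some context. -/
def R1Step (S S' : ShapeGraph Lab Ty) : Prop :=
  ∃ C : Ty × Lab, ∃ t t' : Ty,
    TypeEq S t t' ∧ lt t t' ∧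
    minarity S C t = 0 ∧ minarity S C t' = 1 ∧
    S'.arity C.1 C.2 t = ((1 : ℕ), (S.arity C.1 C.2 t).2) ∧
    S'.arity C.1 C.2 t' = ((0 : ℕ), (S.arity C.1 C.2 t').2) ∧
    ∀ u a s, ¬((u, a) = C ∧ (s = t ∨ s = t')) → S'.arity u a s = S.arity u a s

/-- A single application of rule (R2) in some context. -/
def R2Step (S S' : ShapeGraph Lab Ty) : Prop :=
  ∃ C : Ty × Lab, ∃ t : Ty, ∃ ts : Set Ty, ts.Nonempty ∧
    (∀ G ∈ Lang S, ∀ n ∈ G.nodes, t ∈ G.typing n → ∃ s ∈ ts, s ∈ G.typing n) ∧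
    (∀ s ∈ ts, maxarity S C s = ⊤) ∧
    maxarity S C t ≠ ⊤ ∧
    S'.arity C.1 C.2 t = ((S.arity C.1 C.2 t).1, (⊤ : ℕ∞)) ∧
    ∀ u a s, ¬((u, a) = C ∧ s = t) → S'.arity u a s = S.arity u a s

/-- A single application of rule (R3) in some context. -/
def R3Step (S S' : ShapeGraph Lab Ty) : Prop :=
  ∃ C : Ty × Lab, ∃ t t' : Ty, ∃ ts : Set Ty, ts.Nonempty ∧
    (∀ G ∈ Lang S,
      {n | n ∈ G.nodes ∧ t ∈ G.typing n ∧ ∀ s ∈ ts, s ∉ G.typing n} =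
      {n | n ∈ G.nodes ∧ t' ∈ G.typing n ∧ ∀ s ∈ ts, s ∉ G.typing n}) ∧
    lt t t' ∧
    S.arity C.1 C.2 t' = ((0 : ℕ), (0 : ℕ∞)) ∧
    S.arity C.1 C.2 t = ((0 : ℕ), (1 : ℕ∞)) ∧
    (∀ s ∈ ts, maxarity S C s = ⊤) ∧
    S'.arity C.1 C.2 t = ((0 : ℕ), (0 : ℕ∞)) ∧
    S'.arity C.1 C.2 t' = ((0 : ℕ), (1 : ℕ∞)) ∧
    ∀ u a s, ¬((u, a) = C ∧ (s = t ∨ s = t')) → S'.arity u a s = S.arity u a s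

/-- `S'` is obtained from `S` by exhaustive application of the step relation `Step`:
    reachable by finitely many steps, with no further step applicable. -/
def NF (Step : ShapeGraph Lab Ty → ShapeGraph Lab Ty → Prop)
    (S S' : ShapeGraph Lab Ty) : Prop :=
  Relation.ReflTransGen Step S S' ∧ ∀ S'', ¬ Step S' S''

/-- `CanRel lt S S3` holds iff `S3` is a result `Can^<(S)` of the canonization procedure:
    exhaustive (R1), then exhaustive (R2), then exhaustive (R3). -/
def CanRel (S S3 : ShapeGraph Lab Ty) : Prop :=
  ∃ S1 S2, NF (R1Step lt) S S1 ∧ NF (R2Step) S1 S2 ∧ NF (R3Step lt) S2 S3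

end Rules

/-- Disjoint union of typed graphs, realized on `ℕ` via even/odd encoding. -/
def TypedGraph.dunion (G G' : TypedGraph Lab Ty) : TypedGraph Lab Ty where
  nodes := (fun n => 2 * n) '' G.nodes ∪ (fun n => 2 * n + 1) '' G'.nodes
  edges := (fun e : ℕ × Lab × ℕ => (2 * e.1, e.2.1, 2 * e.2.2)) '' G.edges ∪
           (fun e : ℕ × Lab × ℕ => (2 * e.1 + 1, e.2.1, 2 * e.2.2 + 1)) '' G'.edges
  typing := fun n => if n % 2 = 0 then G.typing (n / 2) else G'.typing (n / 2)
  nodes_finite := (G.nodes_finite.image _).union (G'.nodes_finite.image _)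
  edges_sub := by
    rintro e (⟨f, hf, rfl⟩ | ⟨f, hf, rfl⟩)
    · exact ⟨Set.mem_union_left _ ⟨f.1, (G.edges_sub f hf).1, rfl⟩,
        Set.mem_union_left _ ⟨f.2.2, (G.edges_sub f hf).2, rfl⟩⟩
    · exact ⟨Set.mem_union_right _ ⟨f.1, (G'.edges_sub f hf).1, rfl⟩,
        Set.mem_union_right _ ⟨f.2.2, (G'.edges_sub f hf).2, rfl⟩⟩

end ShEx0

end

namespace ShEx0

variable {Lab Ty : Type}

theorem TypedGraph.edges_finite [Finite Lab] (G : TypedGraph Lab Ty) : G.edges.Finite :=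
  (G.nodes_finite.prod (Set.finite_univ.prod G.nodes_finite)).subset fun e he =>
    ⟨(G.edges_sub e he).1, Set.mem_univ _, (G.edges_sub e he).2⟩

theorem TypedGraph.successors_finite (G : TypedGraph Lab Ty) (n : ℕ) (a : Lab)
    (P : ℕ → Prop) : {m | (n, a, m) ∈ G.edges ∧ P m}.Finite :=
  G.nodes_finite.subset fun _ hm => (G.edges_sub _ hm.1).2

theorem occT_finite (G : TypedGraph Lab Ty) (C : Ty × Lab) (T : Set Ty) : (occT G C T).Finite :=
  (G.nodes_finite.image fun n => cntT G C n T).subset fun _ ⟨n, hn, _, hk⟩ => ⟨n, hn, hk⟩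

theorem cntT_le_maxoccurT (G : TypedGraph Lab Ty) (C : Ty × Lab) (T : Set Ty) {n : ℕ}
    (hn : n ∈ G.nodes) (ht : C.1 ∈ G.typing n) : cntT G C n T ≤ maxoccurT G C T :=
  le_csSup (occT_finite G C T).bddAbove ⟨n, hn, ht, rfl⟩

theorem exists_cntT_eq_maxoccurT (G : TypedGraph Lab Ty) (C : Ty × Lab) (T : Set Ty) {n : ℕ}
    (hn : n ∈ G.nodes) (ht : C.1 ∈ G.typing n) :
    ∃ m ∈ G.nodes, C.1 ∈ G.typing m ∧ cntT G C m T = maxoccurT G C T :=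
  Nat.sSup_mem (s := occT G C T) ⟨_, n, hn, ht, rfl⟩ (occT_finite G C T).bddAbove

/-- In a graph of the language, the number of successors with typeset `T` is bounded by the
sum of the maximal arities of the types in `T`. -/
theorem cntT_le_finsum_maxarity [Finite Lab] [Finite Ty] {S : ShapeGraph Lab Ty}
    {G : TypedGraph Lab Ty} (hG : G ∈ Lang S) (C : Ty × Lab) (T : Set Ty) {n : ℕ}
    (hn : n ∈ G.nodes) (ht : C.1 ∈ G.typing n) :
    (cntT G C n T : ℕ∞) ≤ ∑ᶠ t' ∈ T, maxarity S C t' := by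
  classical
  rw [hG.1 n hn] at ht
  obtain ⟨R, hR, hRn⟩ := ht
  obtain ⟨lam, hlam, hcount⟩ := hR n C.1 hRn
  have hfin := G.successors_finite n C.2 fun m => G.typing m = T
  have hmaps : ∀ m ∈ hfin.toFinset, lam (n, C.2, m) ∈ T.toFinite.toFinset := by
    intro m hm
    obtain ⟨hedge, htyp⟩ := hfin.mem_toFinset.1 hm
    rw [Set.Finite.mem_toFinset, ← htyp, hG.1 m (G.edges_sub _ hedge).2]
    exact ⟨R, hR, hlam (n, C.2, m) ⟨hedge, rfl⟩⟩
  rw [finsum_mem_eq_finite_toFinset_sum _ T.toFinite, cntT, Set.ncard_eq_toFinset_card _ hfin,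
    Finset.card_eq_sum_card_fiberwise hmaps, Nat.cast_sum]
  refine Finset.sum_le_sum fun s _ => le_trans ?_ (hcount C.2 s).2
  rw [← Set.ncard_coe_finset, Nat.cast_le]
  refine Set.ncard_le_ncard_of_injOn (fun m => (n, C.2, m)) ?_ ?_
    (G.edges_finite.subset fun e he => he.1.1)
  · intro m hm
    obtain ⟨hm, hs⟩ := Finset.mem_filter.1 hm
    exact ⟨⟨(hfin.mem_toFinset.1 hm).1, rfl⟩, rfl, hs⟩
  · intro m _ m' _ h
    simpa using h

theorem finsum_maxarity_eq_top_iff [Finite Ty] (S : ShapeGraph Lab Ty) (C : Ty × Lab)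
    (T : Set Ty) :
    ∑ᶠ t' ∈ T, maxarity S C t' = ⊤ ↔ ∃ t' ∈ T, maxarity S C t' = ⊤ := by
  rw [finsum_mem_eq_finite_toFinset_sum _ T.toFinite]
  simp

end ShEx0

open ShEx0 in
theorem maxoccur_of_weaklyChar {Lab Ty : Type} [Fintype Lab] [Fintype Ty] [Nonempty Lab] [Nonempty Ty]
    (S : ShapeGraph Lab Ty) (G : TypedGraph Lab Ty) (hG : WeaklyChar S G)
    (C : Ty × Lab) (T : Set Ty) (hT : T ∈ Typesets S) :
    ((∃ t' ∈ T, maxarity S C t' = ⊤) → T.ncard + 1 ≤ maxoccurT G C T) ∧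
    (¬ (∃ t' ∈ T, maxarity S C t' = ⊤) →
      (maxoccurT G C T : ℕ∞) = ∑ᶠ t' ∈ T, maxarity S C t') := by
  obtain ⟨n, hn, ht, heq, htop⟩ := (hG.2.2 C T hT).2
  rw [ne_eq, finsum_maxarity_eq_top_iff] at heq
  rw [finsum_maxarity_eq_top_iff] at htop
  have hle := cntT_le_maxoccurT G C T hn ht
  refine ⟨fun h => (htop h).trans hle, fun h => le_antisymm ?_ ?_⟩
  · obtain ⟨m, hm, hmt, hmax⟩ := exists_cntT_eq_maxoccurT G C T hn ht
    exact hmax ▸ cntT_le_finsum_maxarity hG.1 C T hm hmt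
  · exact heq h ▸ Nat.cast_le.2 hle
end

section
/- If a shape graph S' is obtained from a shape graph S by a single application of canonization rule (R3) in some context C (i.e., for types t < t' and t1,…,tk such that in every graph of L(S) the set of nodes having type t but none of t1,…,tk equals the set of nodes having type t' but none of t1,…,tk, arity_S^C(t') = [0;0], arity_S^C(t) = [0;1], and maxarity_S^C(ti) = ∞ for all 1 ≤ i ≤ k, setting arity_S^C(t) := [0;0] and arity_S^C(t') := [0;1]), then L(S') = L(S). -/
namespace ShEx0

variable {Lab Ty : Type}

/-- `S₂` arises from `S₁` by moving the interval `[0;1]` from `x` to `y` in the context `C`, and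
every type in `ts` has unbounded arity in that context. -/
structure ArityMove (S₁ S₂ : ShapeGraph Lab Ty) (C : Ty × Lab) (x y : Ty) (ts : Set Ty) : Prop where
  source_left : S₁.arity C.1 C.2 x = (0, 1)
  target_left : S₁.arity C.1 C.2 y = (0, 0)
  source_right : S₂.arity C.1 C.2 x = (0, 0)
  target_right : S₂.arity C.1 C.2 y = (0, 1)
  unbounded : ∀ s ∈ ts, maxarity S₂ C s = ⊤
  eq_of_ne : ∀ u a s, ¬((u, a) = C ∧ (s = x ∨ s = y)) → S₂.arity u a s = S₁.arity u a s

/-- In every graph all of whose nodes are typed, a node of type `x` has type `y` or a type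
in `ts`. -/
def CoveredBy (S : ShapeGraph Lab Ty) (x y : Ty) (ts : Set Ty) : Prop :=
  ∀ G : TypedGraph Lab Ty, (∀ n ∈ G.nodes, ∃ t, Sat S G n t) →
    ∀ n ∈ G.nodes, Sat S G n x → Sat S G n y ∨ ∃ s ∈ ts, Sat S G n s

theorem isPostfix_sat (S : ShapeGraph Lab Ty) (G : TypedGraph Lab Ty) :
    IsPostfix S G (Sat S G) := by
  rintro n t ⟨R, hR, hnt⟩
  obtain ⟨lam, h₁, h₂⟩ := hR n t hnt
  exact ⟨lam, fun e he => ⟨R, hR, h₁ e he⟩, h₂⟩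

/-- One unfolding of the definition suffices to establish satisfaction. -/
theorem sat_of_unfold {S : ShapeGraph Lab Ty} {G : TypedGraph Lab Ty} {n : ℕ} {t : Ty}
    (lam : ℕ × Lab × ℕ → Ty) (h₁ : ∀ e ∈ G.out n, Sat S G e.2.2 (lam e))
    (h₂ : ∀ a s, IvMem (S.arity t a s)
      (Set.ncard {e | e ∈ G.out n ∧ e.2.1 = a ∧ lam e = s})) : Sat S G n t := by
  refine ⟨fun m s => Sat S G m s ∨ (m = n ∧ s = t), ?_, Or.inr ⟨rfl, rfl⟩⟩
  rintro m s (h | ⟨rfl, rfl⟩)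
  · obtain ⟨mu, h₃, h₄⟩ := isPostfix_sat S G m s h
    exact ⟨mu, fun e he => Or.inl (h₃ e he), h₄⟩
  · exact ⟨lam, fun e he => Or.inl (h₁ e he), h₂⟩

/-- Satisfaction depends only on the subgraph reachable from the node. -/
theorem Sat.of_out_eq {S : ShapeGraph Lab Ty} {G H : TypedGraph Lab Ty} (P : ℕ → Prop)
    (hclosed : ∀ n, P n → ∀ e ∈ G.out n, P e.2.2) (hout : ∀ n, P n → H.out n = G.out n)
    {n : ℕ} {t : Ty} (hn : P n) (h : Sat S G n t) : Sat S H n t := by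
  refine ⟨fun m s => P m ∧ Sat S G m s, ?_, hn, h⟩
  rintro m s ⟨hm, hs⟩
  obtain ⟨lam, h₁, h₂⟩ := isPostfix_sat S G m s hs
  refine ⟨lam, ?_, ?_⟩
  · intro e he
    rw [hout m hm] at he
    exact ⟨hclosed m hm e he, h₁ e he⟩
  · rw [hout m hm]
    exact h₂

theorem TypedGraph.out_finite [Finite Lab] (G : TypedGraph Lab Ty) (n : ℕ) :
    (G.out n).Finite := by
  refine (G.nodes_finite.prod ((Set.finite_univ (α := Lab)).prod G.nodes_finite)).subset ?_
  rintro e ⟨he, -⟩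
  exact ⟨(G.edges_sub e he).1, Set.mem_univ _, (G.edges_sub e he).2⟩

theorem ArityMove.exists_reassign {S₁ S₂ : ShapeGraph Lab Ty} {C : Ty × Lab} {x y : Ty}
    {ts : Set Ty} (hmove : ArityMove S₁ S₂ C x y ts) {E : Set (ℕ × Lab × ℕ)} (hE : E.Finite)
    {p : Ty} {lam : ℕ × Lab × ℕ → Ty} {Q : ℕ → Ty → Prop} (hQ : ∀ e ∈ E, Q e.2.2 (lam e))
    (hcard : ∀ a s, IvMem (S₁.arity p a s) (Set.ncard {e | e ∈ E ∧ e.2.1 = a ∧ lam e = s}))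
    (hx : ∀ e ∈ E, Q e.2.2 x → Q e.2.2 y ∨ ∃ s ∈ ts, Q e.2.2 s) :
    ∃ mu : ℕ × Lab × ℕ → Ty, (∀ e ∈ E, Q e.2.2 (mu e)) ∧
      ∀ a s, IvMem (S₂.arity p a s) (Set.ncard {e | e ∈ E ∧ e.2.1 = a ∧ mu e = s}) := by
  classical
  by_cases hp : p = C.1
  swap
  · refine ⟨lam, hQ, fun a s => ?_⟩
    rw [hmove.eq_of_ne p a s (fun h => hp (congrArg Prod.fst h.1))]
    exact hcard a s
  subst hp
  have hxy : x ≠ y := by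
    rintro rfl
    have := hmove.source_left.symm.trans hmove.target_left
    simp at this
  have hxts : x ∉ ts := by
    intro h
    have := hmove.unbounded x h
    simp [maxarity, hmove.source_right] at this
  have hyts : y ∉ ts := by
    intro h
    have := hmove.unbounded y h
    simp [maxarity, hmove.target_right] at this
  have hf : ∀ e, ∃ s, e ∈ E → Q e.2.2 x → Q e.2.2 s ∧ (s = y ∨ s ∈ ts) := by
    intro e
    by_cases h : e ∈ E ∧ Q e.2.2 x
    · rcases hx e h.1 h.2 with h' | ⟨s, hs, h'⟩
      · exact ⟨y, fun _ _ => ⟨h', Or.inl rfl⟩⟩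
      · exact ⟨s, fun _ _ => ⟨h', Or.inr hs⟩⟩
    · exact ⟨x, fun h₁ h₂ => (h ⟨h₁, h₂⟩).elim⟩
  choose f hf using hf
  have hfx : ∀ e ∈ E, lam e = x → Q e.2.2 (f e) ∧ (f e = y ∨ f e ∈ ts) :=
    fun e he hl => hf e he (hl ▸ hQ e he)
  refine ⟨fun e => if e.2.1 = C.2 ∧ lam e = x then f e else lam e, ?_, ?_⟩
  · intro e he
    by_cases h : e.2.1 = C.2 ∧ lam e = x
    · simpa [h] using (hfx e he h.2).1
    · simpa [h] using hQ e he
  intro a s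
  have hfin : ∀ q : ℕ × Lab × ℕ → Prop, {e | e ∈ E ∧ q e}.Finite :=
    fun q => hE.subset fun e he => he.1
  by_cases ha : a = C.2
  swap
  · rw [hmove.eq_of_ne _ a s (fun h => ha (congrArg Prod.snd h.1))]
    convert hcard a s using 5 with e
    grind
  subst ha
  by_cases hsx : s = x
  · subst hsx
    rw [hmove.source_right]
    have : {e | e ∈ E ∧ e.2.1 = C.2 ∧
        (if e.2.1 = C.2 ∧ lam e = s then f e else lam e) = s} = ∅ := by
      ext e
      simp only [Set.mem_ofPred_eq, Set.mem_empty_iff_false, iff_false]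
      grind
    rw [this]
    simp [IvMem]
  by_cases hsy : s = y
  · subst hsy
    rw [hmove.target_right]
    refine ⟨Nat.zero_le _, ?_⟩
    have h₀ := (hcard C.2 s).2
    rw [hmove.target_left] at h₀
    have h₀ : {e | e ∈ E ∧ e.2.1 = C.2 ∧ lam e = s} = ∅ := by
      rw [← Set.ncard_eq_zero (hfin _)]
      simpa using h₀
    have h₁ := (hcard C.2 x).2
    rw [hmove.source_left] at h₁
    refine le_trans ?_ h₁
    refine Nat.cast_le.mpr (Set.ncard_le_ncard ?_ (hfin _))
    intro e he
    have : e ∉ {e | e ∈ E ∧ e.2.1 = C.2 ∧ lam e = s} := by simp [h₀]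
    simp only [Set.mem_ofPred_eq] at he this ⊢
    grind
  rw [hmove.eq_of_ne _ _ s (by grind)]
  by_cases hs : s ∈ ts
  · have htop := hmove.unbounded s hs
    rw [maxarity, hmove.eq_of_ne _ _ s (by grind)] at htop
    refine ⟨(hcard C.2 s).1.trans (Set.ncard_le_ncard ?_ (hfin _)), by simp [htop]⟩
    intro e he
    simp only [Set.mem_ofPred_eq] at he ⊢
    grind
  · convert hcard C.2 s using 3
    ext e
    have := hfx e
    simp only
    grind

theorem ArityMove.sat_of_covered [Finite Lab] {S₁ S₂ : ShapeGraph Lab Ty} {C : Ty × Lab}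
    {x y : Ty} {ts : Set Ty} (hmove : ArityMove S₁ S₂ C x y ts) (hcov : CoveredBy S₁ x y ts)
    {G : TypedGraph Lab Ty} (hG : ∀ n ∈ G.nodes, ∃ t, Sat S₁ G n t) {n : ℕ} {t : Ty}
    (h : Sat S₁ G n t) : Sat S₂ G n t := by
  refine ⟨Sat S₁ G, fun m s hs => ?_, h⟩
  obtain ⟨lam, h₁, h₂⟩ := isPostfix_sat S₁ G m s hs
  exact hmove.exists_reassign (G.out_finite m) h₁ h₂
    fun e he => hcov G hG _ (G.edges_sub e he.1).2

/-- The finite approximants of the satisfaction relation. -/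
def SatUpTo (S : ShapeGraph Lab Ty) (G : TypedGraph Lab Ty) : ℕ → ℕ → Ty → Prop
  | 0, _, _ => True
  | k + 1, n, t => ∃ lam : ℕ × Lab × ℕ → Ty, (∀ e ∈ G.out n, SatUpTo S G k e.2.2 (lam e)) ∧
      ∀ a s, IvMem (S.arity t a s) (Set.ncard {e | e ∈ G.out n ∧ e.2.1 = a ∧ lam e = s})

theorem SatUpTo.of_succ {S : ShapeGraph Lab Ty} {G : TypedGraph Lab Ty} {k n : ℕ} {t : Ty}
    (h : SatUpTo S G (k + 1) n t) : SatUpTo S G k n t := by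
  induction k generalizing n t with
  | zero => trivial
  | succ k ih =>
    obtain ⟨lam, h₁, h₂⟩ := h
    exact ⟨lam, fun e he => ih (h₁ e he), h₂⟩

theorem SatUpTo.mono {S : ShapeGraph Lab Ty} {G : TypedGraph Lab Ty} {j k n : ℕ} {t : Ty}
    (hjk : j ≤ k) (h : SatUpTo S G k n t) : SatUpTo S G j n t := by
  induction hjk with
  | refl => exact h
  | step _ ih => exact ih h.of_succ

theorem sat_of_forall_satUpTo [Finite Lab] [Finite Ty] {S : ShapeGraph Lab Ty}
    {G : TypedGraph Lab Ty} {n : ℕ} {t : Ty} (h : ∀ k, SatUpTo S G k n t) : Sat S G n t := by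
  refine ⟨fun m s => ∀ k, SatUpTo S G k m s, fun m s hs => ?_, h⟩
  have hev : ∀ᶠ k in Filter.atTop, ∀ e ∈ G.out m, ∀ r,
      SatUpTo S G k e.2.2 r → ∀ j, SatUpTo S G j e.2.2 r := by
    rw [Filter.eventually_all_finite (G.out_finite m)]
    intro e _
    rw [Filter.eventually_all]
    intro r
    by_cases hr : ∀ j, SatUpTo S G j e.2.2 r
    · exact Filter.Eventually.of_forall fun _ _ => hr
    · push Not at hr
      obtain ⟨j, hj⟩ := hr
      filter_upwards [Filter.eventually_ge_atTop j] with k hk h'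
      exact (hj (h'.mono hk)).elim
  obtain ⟨k, hk⟩ := hev.exists
  obtain ⟨lam, h₁, h₂⟩ := hs (k + 1)
  exact ⟨lam, fun e he => hk e he _ (h₁ e he), h₂⟩

section Unfolding

variable (S : ShapeGraph Lab Ty) (G : TypedGraph Lab Ty) (R : ℕ → Ty → Prop)
  (lam : ℕ → Ty → ℕ × Lab × ℕ → Ty) (φ : ℕ × Ty × ℕ ≃ ℕ)

/-- The triples `(v, p, i)` which are nodes of the unfolding of depth `k`: `v` is a node of `G`
with `R v p` from which `i` further steps are unfolded; at `i = 0` a minimal model of `p`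
is attached. -/
def UnfoldNode (k : ℕ) (z : ℕ × Ty × ℕ) : Prop :=
  z.1 ∈ G.nodes ∧ z.2.2 ≤ k ∧ (∃ w, R w z.2.1) ∧ (z.2.2 ≠ 0 → R z.1 z.2.1)

/-- The edges of the unfolding: those of `G` along the type assignment `lam` above level `0`, and
one edge for every mandatory successor type at level `0`. -/
def UnfoldEdge (z : ℕ × Ty × ℕ) (a : Lab) (z' : ℕ × Ty × ℕ) : Prop :=
  (z.2.2 = 0 ∧ z'.2.2 = 0 ∧ z'.1 = z.1 ∧ (S.arity z.2.1 a z'.2.1).1 = 1) ∨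
  (z.2.2 = z'.2.2 + 1 ∧ (z.1, a, z'.1) ∈ G.edges ∧ z'.2.1 = lam z.1 z.2.1 (z.1, a, z'.1))

/-- The part of depth at most `k` of the unfolding of `G` along the runs `lam` witnessing `R`. -/
def unfolding [Finite Ty] (k : ℕ) : TypedGraph Lab Ty where
  nodes := {n | UnfoldNode G R k (φ.symm n)}
  edges := {e | UnfoldNode G R k (φ.symm e.1) ∧ UnfoldNode G R k (φ.symm e.2.2) ∧
    UnfoldEdge S G lam (φ.symm e.1) e.2.1 (φ.symm e.2.2)}
  typing := fun _ => ∅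
  nodes_finite := by
    refine ((G.nodes_finite.prod ((Set.finite_univ (α := Ty)).prod
      (Set.finite_Iic k))).image φ).subset ?_
    intro n hn
    exact ⟨φ.symm n, ⟨hn.1, Set.mem_univ _, hn.2.1⟩, φ.apply_symm_apply n⟩
  edges_sub := fun _ he => ⟨he.1, he.2.1⟩

variable {S G R lam φ}

theorem UnfoldNode.mono {j k : ℕ} (hjk : j ≤ k) {z : ℕ × Ty × ℕ} (hz : UnfoldNode G R j z) :
    UnfoldNode G R k z :=
  ⟨hz.1, hz.2.1.trans hjk, hz.2.2⟩

theorem UnfoldEdge.level_le {z z' : ℕ × Ty × ℕ} {a : Lab} (h : UnfoldEdge S G lam z a z') :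
    z'.2.2 ≤ z.2.2 := by
  rcases h with h | h <;> omega

variable [Finite Ty]

theorem unfolding_out_eq {j k : ℕ} (hjk : j ≤ k) {n : ℕ} (hn : UnfoldNode G R j (φ.symm n)) :
    (unfolding S G R lam φ k).out n = (unfolding S G R lam φ j).out n := by
  ext e
  constructor
  · rintro ⟨⟨h₁, h₂, h₃⟩, rfl⟩
    exact ⟨⟨hn, ⟨h₂.1, h₃.level_le.trans hn.2.1, h₂.2.2⟩, h₃⟩, rfl⟩
  · rintro ⟨⟨h₁, h₂, h₃⟩, rfl⟩
    exact ⟨⟨h₁.mono hjk, h₂.mono hjk, h₃⟩, rfl⟩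

theorem Sat.unfolding_mono {T : ShapeGraph Lab Ty} {j k : ℕ} (hjk : j ≤ k) {n : ℕ}
    (hn : UnfoldNode G R j (φ.symm n)) {t : Ty} (h : Sat T (unfolding S G R lam φ j) n t) :
    Sat T (unfolding S G R lam φ k) n t :=
  h.of_out_eq (fun n => UnfoldNode G R j (φ.symm n)) (fun _ _ e (he : e ∈ (unfolding S G R lam φ j).out _) => he.1.2.1)
    (fun _ hm => unfolding_out_eq hjk hm) hn

/-- Above level `0`, the outgoing edges of `(v, p, i + 1)` correspond to those of `v`. -/
theorem unfolding_ncard_out (hlam : ∀ v p, R v p → ∀ e ∈ G.out v, R e.2.2 (lam v p e))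
    {k v i : ℕ} {p : Ty} (hv : v ∈ G.nodes) (hR : R v p) (hi : i + 1 ≤ k)
    (mu : ℕ × Lab × ℕ → Ty) (a : Lab) (s : Ty) :
    Set.ncard {e | e ∈ (unfolding S G R lam φ k).out (φ (v, p, i + 1)) ∧ e.2.1 = a ∧ mu e = s} =
      Set.ncard {e | e ∈ G.out v ∧ e.2.1 = a ∧
        mu (φ (v, p, i + 1), e.2.1, φ (e.2.2, lam v p e, i)) = s} := by
  symm
  refine Set.ncard_congr
    (fun e _ => (φ (v, p, i + 1), e.2.1, φ (e.2.2, lam v p e, i))) ?_ ?_ ?_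
  · rintro ⟨v', b, w⟩ ⟨⟨he, rfl⟩, rfl, hs⟩
    have hw := hlam _ _ hR _ ⟨he, rfl⟩
    refine ⟨⟨⟨?_, ?_, ?_⟩, rfl⟩, rfl, hs⟩
    · simpa using ⟨hv, hi, ⟨_, hR⟩, fun _ => hR⟩
    · simpa using ⟨(G.edges_sub _ he).2, by simp; omega, ⟨_, hw⟩, fun _ => hw⟩
    · exact Or.inr (by simpa using he)
  · rintro ⟨v₁, b₁, w₁⟩ ⟨v₂, b₂, w₂⟩ ⟨⟨-, rfl⟩, -⟩ ⟨⟨-, h⟩, -⟩ heq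
    simp only [Prod.mk.injEq, EmbeddingLike.apply_eq_iff_eq] at heq h ⊢
    exact ⟨h.symm, heq.2.1, heq.2.2.1⟩
  · rintro ⟨n, b, m⟩ ⟨⟨⟨-, -, he⟩, rfl⟩, rfl, hs⟩
    obtain ⟨⟨w, q, j⟩, rfl⟩ := φ.surjective m
    simp only [UnfoldEdge, Equiv.symm_apply_apply] at he
    rcases he with he | ⟨h₁, h₂, h₃⟩
    · simp at he
    · obtain rfl : i = j := by omega
      subst h₃
      exact ⟨(v, b, w), ⟨⟨h₂, rfl⟩, rfl, hs⟩, rfl⟩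

/-- At level `0` the unfolding is a minimal model of each of its types. -/
theorem sat_unfolding_zero (hmem : ∀ v p, R v p → ∀ a s,
      ((S.arity p a s).1 : ℕ∞) ≤ (S.arity p a s).2 ∧
      ((S.arity p a s).1 = 1 → ∃ w, R w s))
    {k v : ℕ} {p : Ty} (hv : v ∈ G.nodes) (hp : ∃ w, R w p) :
    Sat S (unfolding S G R lam φ k) (φ (v, p, 0)) p := by
  refine ⟨fun n q => ∃ v ∈ G.nodes, (∃ w, R w q) ∧ n = φ (v, q, 0), ?_, v, hv, hp, rfl⟩
  rintro n q ⟨v, hv, ⟨w, hw⟩, rfl⟩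
  refine ⟨fun e => (φ.symm e.2.2).2.1, ?_, fun a s => ?_⟩
  · rintro ⟨n, b, m⟩ ⟨⟨-, hm, he⟩, rfl⟩
    obtain ⟨⟨w, q', j⟩, rfl⟩ := φ.surjective m
    simp only [UnfoldEdge, Equiv.symm_apply_apply] at he hm ⊢
    rcases he with ⟨-, rfl, rfl, -⟩ | he
    · exact ⟨w, hv, hm.2.2.1, rfl⟩
    · omega
  · have hcard : Set.ncard {e | e ∈ (unfolding S G R lam φ k).out (φ (v, q, 0)) ∧ e.2.1 = a ∧
        (φ.symm e.2.2).2.1 = s} = (S.arity q a s).1 := by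
      have hle : (S.arity q a s).1 ≤ 1 := (S.basic q a s).1
      by_cases h₁ : (S.arity q a s).1 = 1
      · rw [h₁, Set.ncard_eq_one]
        refine ⟨(φ (v, q, 0), a, φ (v, s, 0)), Set.Subset.antisymm ?_ ?_⟩
        · rintro ⟨n, b, m⟩ ⟨⟨⟨-, -, he⟩, rfl⟩, rfl, hs⟩
          obtain ⟨⟨w, q', j⟩, rfl⟩ := φ.surjective m
          simp only [UnfoldEdge, Equiv.symm_apply_apply] at he hs
          rcases he with ⟨-, rfl, rfl, -⟩ | he
          · subst hs
            rfl
          · omega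
        · rintro _ rfl
          have hs := (hmem w q hw a s).2 h₁
          refine ⟨⟨⟨?_, ?_, ?_⟩, rfl⟩, rfl, by simp⟩
          · simpa using ⟨hv, Nat.zero_le _, ⟨w, hw⟩, fun h => (h rfl).elim⟩
          · simpa using ⟨hv, Nat.zero_le _, hs, fun h => (h rfl).elim⟩
          · exact Or.inl (by simpa using h₁)
      · have h₀ : (S.arity q a s).1 = 0 := by omega
        rw [h₀]
        convert Set.ncard_empty (ℕ × Lab × ℕ)
        ext ⟨n, b, m⟩
        simp only [Set.mem_ofPred_eq, Set.mem_empty_iff_false, iff_false]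
        rintro ⟨⟨⟨-, -, he⟩, rfl⟩, rfl, rfl⟩
        simp only [UnfoldEdge, Equiv.symm_apply_apply] at he
        rcases he with he | he
        · exact h₁ he.2.2.2
        · omega
    rw [hcard]
    exact ⟨le_rfl, (hmem w q hw a s).1⟩

/-- Satisfaction at level `i` of the unfolding implies the `i`-th approximant in `G`. -/
theorem satUpTo_of_sat_unfolding (hlam : ∀ v p, R v p → ∀ e ∈ G.out v, R e.2.2 (lam v p e))
    {T : ShapeGraph Lab Ty} {k i v : ℕ} {p q : Ty} (hv : v ∈ G.nodes) (hR : R v p) (hi : i ≤ k)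
    (h : Sat T (unfolding S G R lam φ k) (φ (v, p, i)) q) : SatUpTo T G i v q := by
  induction i generalizing v p q with
  | zero => trivial
  | succ i ih =>
    obtain ⟨mu, h₁, h₂⟩ := isPostfix_sat _ _ _ _ h
    refine ⟨fun e => mu (φ (v, p, i + 1), e.2.1, φ (e.2.2, lam v p e, i)), ?_, fun a s => ?_⟩
    · rintro ⟨v', b, w⟩ ⟨he, rfl⟩
      have hw := hlam _ _ hR _ ⟨he, rfl⟩
      refine ih (p := lam v' p (v', b, w)) (G.edges_sub _ he).2 hw (by omega)
        (h₁ (φ (v', p, i + 1), b, φ (w, lam v' p (v', b, w), i)) ⟨⟨?_, ?_, ?_⟩, rfl⟩)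
      · simpa using ⟨hv, hi, ⟨_, hR⟩, fun _ => hR⟩
      · simpa using ⟨(G.edges_sub _ he).2, by simp; omega, ⟨_, hw⟩, fun _ => hw⟩
      · exact Or.inr (by simpa using he)
    · rw [← unfolding_ncard_out hlam hv hR hi]
      exact h₂ a s

/-- Every node of the unfolding along `S₁`-runs has its type with respect to `S₂`. -/
theorem ArityMove.sat_unfolding [Finite Lab] {S₁ S₂ : ShapeGraph Lab Ty} {C : Ty × Lab} {x y : Ty}
    {ts : Set Ty} (hmove : ArityMove S₁ S₂ C x y ts) (hcov : CoveredBy S₂ x y ts)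
    (hlam : ∀ v p, R v p → ∀ e ∈ G.out v, R e.2.2 (lam v p e))
    (hcard : ∀ v p, R v p → ∀ a s, IvMem (S₁.arity p a s)
      (Set.ncard {e | e ∈ G.out v ∧ e.2.1 = a ∧ lam v p e = s}))
    (hmem : ∀ v p, R v p → ∀ a s,
      ((S₂.arity p a s).1 : ℕ∞) ≤ (S₂.arity p a s).2 ∧
      ((S₂.arity p a s).1 = 1 → ∃ w, R w s))
    (k : ℕ) (z : ℕ × Ty × ℕ) (hz : UnfoldNode G R k z) :
    Sat S₂ (unfolding S₂ G R lam φ k) (φ z) z.2.1 := by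
  induction k generalizing z with
  | zero =>
    obtain ⟨v, p, i⟩ := z
    obtain rfl : i = 0 := Nat.le_zero.mp hz.2.1
    exact sat_unfolding_zero hmem hz.1 hz.2.2.1
  | succ k ih =>
    by_cases hk : z.2.2 ≤ k
    · have hz' : UnfoldNode G R k z := ⟨hz.1, hk, hz.2.2⟩
      exact (ih z hz').unfolding_mono (Nat.le_succ k) (by simpa using hz')
    obtain ⟨v, p, i⟩ := z
    obtain rfl : i = k + 1 := le_antisymm hz.2.1 (by simpa using hk)
    have hR : R v p := hz.2.2.2 (Nat.succ_ne_zero k)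
    have htarget : ∀ e ∈ (unfolding S₂ G R lam φ (k + 1)).out (φ (v, p, k + 1)),
        UnfoldNode G R k (φ.symm e.2.2) ∧
        (φ.symm e.2.2).2.1 =
          lam v p (v, e.2.1, (φ.symm e.2.2).1) := by
      rintro ⟨n, b, m⟩ ⟨⟨-, hm, he⟩, rfl⟩
      obtain ⟨⟨w, q, j⟩, rfl⟩ := φ.surjective m
      simp only [UnfoldEdge, Equiv.symm_apply_apply] at he hm ⊢
      rcases he with he | ⟨h₁, -, h₃⟩
      · omega
      · exact ⟨⟨hm.1, by simp; omega, hm.2.2⟩, h₃⟩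
    have htyped : ∀ n ∈ (unfolding S₂ G R lam φ k).nodes,
        ∃ t, Sat S₂ (unfolding S₂ G R lam φ k) n t := by
      intro n hn
      have := ih (φ.symm n) hn
      rw [Equiv.apply_symm_apply] at this
      exact ⟨_, this⟩
    obtain ⟨mu, h₁, h₂⟩ := hmove.exists_reassign
      ((unfolding S₂ G R lam φ (k + 1)).out_finite (φ (v, p, k + 1)))
      (p := p) (lam := fun e => (φ.symm e.2.2).2.1) (Q := Sat S₂ (unfolding S₂ G R lam φ k))
      (fun e he => by
        have := ih _ (htarget e he).1
        rwa [Equiv.apply_symm_apply] at this)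
      (fun a s => by
        rw [unfolding_ncard_out hlam hz.1 hR le_rfl]
        simpa using hcard v p hR a s)
      (fun e he => hcov _ htyped _ (htarget e he).1)
    exact sat_of_unfold mu
      (fun e he => (h₁ e he).unfolding_mono (Nat.le_succ k) (htarget e he).1) h₂

end Unfolding

theorem ArityMove.sat_of_covered_right [Finite Lab] [Finite Ty] {S₁ S₂ : ShapeGraph Lab Ty}
    {C : Ty × Lab} {x y : Ty} {ts : Set Ty} (hmove : ArityMove S₁ S₂ C x y ts)
    (hcov : CoveredBy S₂ x y ts) {G : TypedGraph Lab Ty} {n : ℕ} {t : Ty} (hn : n ∈ G.nodes)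
    (h : Sat S₁ G n t) : Sat S₂ G n t := by
  have : Nonempty Ty := ⟨t⟩
  obtain ⟨φ⟩ : Nonempty (ℕ × Ty × ℕ ≃ ℕ) := nonempty_equiv_of_countable
  have hrun : ∀ v p, ∃ lam : ℕ × Lab × ℕ → Ty, Sat S₁ G v p →
      (∀ e ∈ G.out v, Sat S₁ G e.2.2 (lam e)) ∧ ∀ a s, IvMem (S₁.arity p a s)
        (Set.ncard {e | e ∈ G.out v ∧ e.2.1 = a ∧ lam e = s}) := by
    intro v p
    by_cases hp : Sat S₁ G v p
    · obtain ⟨lam, hl⟩ := isPostfix_sat S₁ G v p hp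
      exact ⟨lam, fun _ => hl⟩
    · exact ⟨fun _ => t, fun hp' => (hp hp').elim⟩
  choose lam hlam using hrun
  have hmem : ∀ v p, Sat S₁ G v p → ∀ a s,
      ((S₂.arity p a s).1 : ℕ∞) ≤ (S₂.arity p a s).2 ∧
      ((S₂.arity p a s).1 = 1 → ∃ w, Sat S₁ G w s) := by
    intro v p hp a s
    by_cases hC : (p, a) = C ∧ (s = x ∨ s = y)
    · obtain ⟨rfl, rfl | rfl⟩ := hC
      · simp [hmove.source_right]
      · simp [hmove.target_right]
    rw [hmove.eq_of_ne p a s hC]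
    have hc := (hlam v p hp).2 a s
    refine ⟨(Nat.cast_le.mpr hc.1).trans hc.2, fun h₁ => ?_⟩
    have hpos := h₁ ▸ hc.1
    obtain ⟨e, he, -, rfl⟩ := Set.nonempty_of_ncard_ne_zero (Nat.one_le_iff_ne_zero.mp hpos)
    exact ⟨_, (hlam v p hp).1 e he⟩
  refine sat_of_forall_satUpTo fun k => ?_
  exact satUpTo_of_sat_unfolding (φ := φ) (S := S₂) (fun v p hp => (hlam v p hp).1) hn h le_rfl
    (hmove.sat_unfolding hcov (fun v p hp => (hlam v p hp).1) (fun v p hp => (hlam v p hp).2)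
      hmem k (n, t, k) ⟨hn, le_rfl, ⟨n, h⟩, fun _ => h⟩)

/-- A semantic inclusion relative to the language holds for satisfaction in typed graphs. -/
theorem coveredBy_of_lang {S : ShapeGraph Lab Ty} {x y : Ty} {ts : Set Ty}
    (h : ∀ G ∈ Lang S, {n | n ∈ G.nodes ∧ x ∈ G.typing n ∧ ∀ s ∈ ts, s ∉ G.typing n} ⊆
      {n | n ∈ G.nodes ∧ y ∈ G.typing n ∧ ∀ s ∈ ts, s ∉ G.typing n}) :
    CoveredBy S x y ts := by
  intro G hG n hn hx
  by_cases hs : ∃ s ∈ ts, Sat S G n s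
  · exact Or.inr hs
  · push Not at hs
    exact Or.inl (h { G with typing := fun n => {t | Sat S G n t} } ⟨fun _ _ => rfl, hG⟩
      ⟨hn, hx, hs⟩).2.1

end ShEx0

open ShEx0 in
theorem r3_preserves_lang {Lab Ty : Type} [Fintype Lab] [Fintype Ty] [Nonempty Lab] [Nonempty Ty]
    (lt : Ty → Ty → Prop) [IsStrictTotalOrder Ty lt]
    (S S' : ShapeGraph Lab Ty) (h : R3Step lt S S') :
    Lang S' = Lang S := by
  obtain ⟨C, t, t', ts, -, heq, hlt, hSt', hSt, hts, hS't, hS't', hrest⟩ := h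
  have htts : ∀ s ∈ ts, s ≠ t ∧ s ≠ t' := by
    intro s hs
    have := hts s hs
    constructor <;> rintro rfl
    · simp [maxarity, hSt] at this
    · simp [maxarity, hSt'] at this
  have hmove : ArityMove S S' C t t' ts :=
    ⟨hSt, hSt', hS't, hS't', fun s hs => by
      rw [maxarity, hrest _ _ _ fun hc => hc.2.elim (htts s hs).1 (htts s hs).2]
      exact hts s hs, hrest⟩
  have hmove' : ArityMove S' S C t' t ts :=
    ⟨hS't', hS't, hSt', hSt, hts, fun u a s hc =>
      (hrest u a s fun hc' => hc ⟨hc'.1, hc'.2.symm⟩).symm⟩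
  have hcov : CoveredBy S t t' ts := coveredBy_of_lang fun G hG => (heq G hG).subset
  have hcov' : CoveredBy S t' t ts := coveredBy_of_lang fun G hG => (heq G hG).superset
  have key : ∀ G : TypedGraph Lab Ty, (∀ n ∈ G.nodes, ∃ p, Sat S G n p) → ∀ n ∈ G.nodes,
      {p | Sat S' G n p} = {p | Sat S G n p} := fun G hG n hn =>
    Set.Subset.antisymm (fun p hp => hmove'.sat_of_covered_right hcov' hn hp)
      (fun p hp => hmove.sat_of_covered hcov hG hp)
  ext G
  constructor
  · rintro ⟨h₁, h₂⟩
    refine ⟨fun n hn => (h₁ n hn).trans (key G (fun m hm => ?_) n hn), h₂⟩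
    obtain ⟨p, hp⟩ := h₂ m hm
    rw [h₁ m hm] at hp
    exact ⟨p, hmove'.sat_of_covered_right hcov' hm hp⟩
  · rintro ⟨h₁, h₂⟩
    refine ⟨fun n hn => (h₁ n hn).trans (key G (fun m hm => ?_) n hn).symm, h₂⟩
    obtain ⟨p, hp⟩ := h₂ m hm
    rw [h₁ m hm] at hp
    exact ⟨p, hp⟩
end

section
/- The language of a shape graph is closed under disjoint union: for every shape graph S and all typed graph G, G' ∈ L(S), the disjoint union G ⊎ G' also belongs to L(S). -/
namespace ShEx0

variable {Lab Ty : Type}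

/-- The map on edges induced by a map on nodes. -/
def edgeMap (f : ℕ → ℕ) (e : ℕ × Lab × ℕ) : ℕ × Lab × ℕ := (f e.1, e.2.1, f e.2.2)

lemma edgeMap_injective {f : ℕ → ℕ} (hf : Function.Injective f) :
    Function.Injective (edgeMap (Lab := Lab) f) := by
  rintro ⟨a, b, c⟩ ⟨a', b', c'⟩ h
  simp only [edgeMap, Prod.mk.injEq] at h
  rw [hf h.1, h.2.1, hf h.2.2]

/-- An injective map of nodes preserving outbound neighbourhoods preserves counts of edges. -/
lemma ncard_out_edgeMap {G H : TypedGraph Lab Ty} {f : ℕ → ℕ} (hf : Function.Injective f)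
    {n : ℕ} (hout : H.out (f n) = edgeMap f '' G.out n) (lam : ℕ × Lab × ℕ → Ty)
    (a : Lab) (s : Ty) :
    Set.ncard {e | e ∈ H.out (f n) ∧ e.2.1 = a ∧ lam e = s} =
      Set.ncard {e | e ∈ G.out n ∧ e.2.1 = a ∧ lam (edgeMap f e) = s} := by
  rw [← Set.ncard_image_of_injective {e | e ∈ G.out n ∧ e.2.1 = a ∧ lam (edgeMap f e) = s}
    (edgeMap_injective hf), hout]
  congr 1
  ext e
  constructor
  · rintro ⟨⟨e, he, rfl⟩, h⟩
    exact ⟨e, ⟨he, h⟩, rfl⟩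
  · rintro ⟨e, ⟨he, h⟩, rfl⟩
    exact ⟨⟨e, he, rfl⟩, h⟩

/-- Satisfaction is invariant under injective maps preserving outbound neighbourhoods. -/
lemma sat_iff_of_out_eq_image (S : ShapeGraph Lab Ty) {G H : TypedGraph Lab Ty} {f : ℕ → ℕ}
    (hf : Function.Injective f) (hout : ∀ n, H.out (f n) = edgeMap f '' G.out n)
    (n : ℕ) (t : Ty) : Sat S H (f n) t ↔ Sat S G n t := by
  constructor
  · rintro ⟨R, hR, hn⟩
    refine ⟨fun m u => R (f m) u, fun m u hm => ?_, hn⟩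
    obtain ⟨lam, hlam, hcount⟩ := hR _ _ hm
    refine ⟨fun e => lam (edgeMap f e), fun e he => ?_, fun a s => ?_⟩
    · exact hlam (edgeMap f e) (hout m ▸ Set.mem_image_of_mem _ he)
    · rw [← ncard_out_edgeMap hf (hout m)]
      exact hcount a s
  · rintro ⟨R, hR, hn⟩
    refine ⟨fun m u => ∃ k, f k = m ∧ R k u, ?_, n, rfl, hn⟩
    rintro _ u ⟨m, rfl, hm⟩
    obtain ⟨lam, hlam, hcount⟩ := hR _ _ hm
    have hext := (edgeMap_injective (Lab := Lab) hf).extend_apply lam fun _ => u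
    refine ⟨Function.extend (edgeMap f) lam fun _ => u, fun e he => ?_, fun a s => ?_⟩
    · rw [hout m] at he
      obtain ⟨e, he, rfl⟩ := he
      exact ⟨e.2.2, rfl, by rw [hext]; exact hlam e he⟩
    · rw [ncard_out_edgeMap hf (hout m)]
      simpa only [hext] using hcount a s

lemma out_dunion_left (G G' : TypedGraph Lab Ty) (n : ℕ) :
    (G.dunion G').out (2 * n) = edgeMap (fun k => 2 * k) '' G.out n := by
  ext e
  constructor
  · rintro ⟨⟨e, he, rfl⟩ | ⟨e, he, rfl⟩, h⟩
    · exact ⟨e, ⟨he, by dsimp only at h; omega⟩, rfl⟩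
    · dsimp only at h; omega
  · rintro ⟨e, ⟨he, rfl⟩, rfl⟩
    exact ⟨Or.inl ⟨e, he, rfl⟩, rfl⟩

lemma out_dunion_right (G G' : TypedGraph Lab Ty) (n : ℕ) :
    (G.dunion G').out (2 * n + 1) = edgeMap (fun k => 2 * k + 1) '' G'.out n := by
  ext e
  constructor
  · rintro ⟨⟨e, he, rfl⟩ | ⟨e, he, rfl⟩, h⟩
    · dsimp only at h; omega
    · exact ⟨e, ⟨he, by dsimp only at h; omega⟩, rfl⟩
  · rintro ⟨e, ⟨he, rfl⟩, rfl⟩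
    exact ⟨Or.inr ⟨e, he, rfl⟩, rfl⟩

lemma typing_dunion_left (G G' : TypedGraph Lab Ty) (n : ℕ) :
    (G.dunion G').typing (2 * n) = G.typing n := by
  simp [TypedGraph.dunion]

lemma typing_dunion_right (G G' : TypedGraph Lab Ty) (n : ℕ) :
    (G.dunion G').typing (2 * n + 1) = G'.typing n := by
  have h : (2 * n + 1) / 2 = n := by omega
  simp [TypedGraph.dunion, Nat.add_mod, h]

lemma sat_dunion_left (S : ShapeGraph Lab Ty) (G G' : TypedGraph Lab Ty) (n : ℕ) (t : Ty) :
    Sat S (G.dunion G') (2 * n) t ↔ Sat S G n t :=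
  sat_iff_of_out_eq_image S (f := fun k => 2 * k) (fun a b h => by dsimp only at h; omega)
    (out_dunion_left G G') n t

lemma sat_dunion_right (S : ShapeGraph Lab Ty) (G G' : TypedGraph Lab Ty) (n : ℕ) (t : Ty) :
    Sat S (G.dunion G') (2 * n + 1) t ↔ Sat S G' n t :=
  sat_iff_of_out_eq_image S (f := fun k => 2 * k + 1) (fun a b h => by dsimp only at h; omega)
    (out_dunion_right G G') n t

end ShEx0

open ShEx0 in
theorem lang_closed_dunion {Lab Ty : Type} [Fintype Lab] [Fintype Ty] [Nonempty Lab] [Nonempty Ty]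
    (S : ShapeGraph Lab Ty) (G G' : TypedGraph Lab Ty)
    (hG : G ∈ Lang S) (hG' : G' ∈ Lang S) :
    G.dunion G' ∈ Lang S := by
  constructor
  · rintro _ (⟨n, hn, rfl⟩ | ⟨n, hn, rfl⟩)
    · simp only [typing_dunion_left, sat_dunion_left]
      exact hG.1 n hn
    · simp only [typing_dunion_right, sat_dunion_right]
      exact hG'.1 n hn
  · rintro _ (⟨n, hn, rfl⟩ | ⟨n, hn, rfl⟩)
    · simp only [typing_dunion_left]
      exact hG.2 n hn
    · simp only [typing_dunion_right]
      exact hG'.2 n hn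
end
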